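/- Let n ≥ 1, X = {0, 1, …, n}³, h > 0, Q ⊆ X nonempty, q : Q → ℝ, F : X → (0, ∞), and let U : X → ℝ solve the discretized Eikonal system. Let x₀, x₁, …, x_L be any path in X such that x_{k} and x_{k+1} are grid neighbors for each k, x_L ∈ Q, and x_k ∉ Q for all k < L. Then U(x₀) ≤ q(x_L) + h · Σ_{k=0}^{L−1} 1/F(x_k). In particular, the discrete solution is bounded above by the travel cost of any grid path to the exit set. -/

import Mathlib

/-- The grid X = {0, 1, …, n}³, represented as functions Fin 3 → Fin (n+1). -/
abbrev Grid (n : ℕ) := Fin 3 → Fin (n + 1)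

/-- `y` is a grid neighbor of `x` along axis `a`: they agree in all other
coordinates and differ by exactly 1 in coordinate `a`. -/
def AxisNbr {n : ℕ} (a : Fin 3) (x y : Grid n) : Prop :=
  (∀ b, b ≠ a → y b = x b) ∧ ((y a : ℤ) - (x a : ℤ)).natAbs = 1

/-- m_a(U, x): the minimum of U over the grid neighbors of x along axis a. -/
noncomputable def axMin {n : ℕ} (U : Grid n → ℝ) (x : Grid n) (a : Fin 3) : ℝ :=
  sInf {v | ∃ y : Grid n, AxisNbr a x y ∧ U y = v}

/-- U solves the discretized Eikonal system with stepsize `hs`, exit set `Q`,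
exit penalty `q`, and speed `F`. -/
def SolvesEikonal {n : ℕ} (hs : ℝ) (Q : Set (Grid n)) (q F U : Grid n → ℝ) : Prop :=
  (∀ x ∈ Q, U x = q x) ∧
  ∀ x : Grid n, x ∉ Q →
    ∑ a : Fin 3, max (U x - axMin U x a) 0 ^ 2 = hs ^ 2 / F x ^ 2

/-- `y` is a grid neighbor of `x` (differ by 1 in exactly one coordinate). -/
def IsNbr {n : ℕ} (x y : Grid n) : Prop :=
  ∑ a : Fin 3, ((x a : ℤ) - (y a : ℤ)).natAbs = 1

theorem IsNbr.exists_axisNbr {n : ℕ} {x y : Grid n} (h : IsNbr x y) : ∃ a, AxisNbr a x y := by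
  simp only [IsNbr, Fin.sum_univ_three] at h
  have key : ((x 0 : ℤ) - (y 0 : ℤ)).natAbs = 1 ∨ ((x 1 : ℤ) - (y 1 : ℤ)).natAbs = 1 ∨
      ((x 2 : ℤ) - (y 2 : ℤ)).natAbs = 1 := by omega
  rcases key with h' | h' | h'
  · refine ⟨0, fun b hb => ?_, by omega⟩
    fin_cases b <;> simp_all [Fin.ext_iff] <;> omega
  · refine ⟨1, fun b hb => ?_, by omega⟩
    fin_cases b <;> simp_all [Fin.ext_iff] <;> omega
  · refine ⟨2, fun b hb => ?_, by omega⟩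
    fin_cases b <;> simp_all [Fin.ext_iff] <;> omega

theorem axMin_le {n : ℕ} (U : Grid n → ℝ) {x y : Grid n} {a : Fin 3} (h : AxisNbr a x y) :
    axMin U x a ≤ U y :=
  csInf_le ((Set.finite_range U).subset (by rintro _ ⟨z, -, rfl⟩; exact ⟨z, rfl⟩)).bddBelow
    ⟨y, h, rfl⟩

/-- A discrete solution decreases by at most `hs / F x` along a grid step leaving `x ∉ Q`. -/
theorem SolvesEikonal.le_add_of_isNbr {n : ℕ} {hs : ℝ} {Q : Set (Grid n)} {q F U : Grid n → ℝ}
    (hU : SolvesEikonal hs Q q F U) (hhs : 0 ≤ hs) {x y : Grid n} (hF : 0 < F x) (hx : x ∉ Q)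
    (hxy : IsNbr x y) : U x ≤ U y + hs * (1 / F x) := by
  obtain ⟨a, ha⟩ := hxy.exists_axisNbr
  have hle : max (U x - axMin U x a) 0 ^ 2 ≤ (hs / F x) ^ 2 := by
    rw [div_pow, ← hU.2 x hx]
    exact Finset.single_le_sum (f := fun a => max (U x - axMin U x a) 0 ^ 2)
      (fun _ _ => sq_nonneg _) (Finset.mem_univ a)
  have hmax := abs_le_of_sq_le_sq' hle (by positivity)
  have hsub := (le_max_left (U x - axMin U x a) 0).trans hmax.2
  rw [mul_one_div]
  linarith [axMin_le U ha]

/-- The discrete solution is bounded above by the travel cost of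
any grid path to the exit set: for a path x₀, …, x_L of grid neighbors with
x_L ∈ Q and x_k ∉ Q for k < L,
U(x₀) ≤ q(x_L) + h · Σ_{k=0}^{L−1} 1/F(x_k). -/
theorem eikonal_path_upper_bound (n : ℕ) (hn : 1 ≤ n) (hs : ℝ) (hhs : 0 < hs)
    (Q : Set (Grid n)) (hQ : Q.Nonempty) (q F U : Grid n → ℝ) (hF : ∀ x, 0 < F x)
    (hU : SolvesEikonal hs Q q F U)
    (L : ℕ) (x : ℕ → Grid n)
    (hpath : ∀ k < L, IsNbr (x k) (x (k + 1)))
    (hexit : x L ∈ Q) (hnot : ∀ k < L, x k ∉ Q) :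
    U (x 0) ≤ q (x L) + hs * ∑ k ∈ Finset.range L, 1 / F (x k) := by
  rw [← hU.1 _ hexit]
  have hbound : ∀ m ≤ L,
      U (x 0) ≤ U (x m) + hs * ∑ k ∈ Finset.range m, 1 / F (x k) := by
    intro m
    induction m with
    | zero => simp
    | succ m ih =>
      intro hm
      have hstep := hU.le_add_of_isNbr hhs.le (hF _) (hnot m hm) (hpath m hm)
      rw [Finset.sum_range_succ, mul_add]
      linarith [ih (Nat.le_of_succ_le hm)]
  exact hbound L le_rfl
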